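/- arXiv:0912.4887 — 4 statements merged into one kernel-verified Lean document; each statement's English description precedes it below -/
import Mathlib

section
/- Let f : X → Y be a universal homeomorphism of finite type between Noetherian schemes over ℚ. Then there exists a finite partition {Y_1, …, Y_r} of the underlying topological space of Y into locally closed subsets such that, endowing each Y_i with its reduced induced subscheme structure, the projection morphism (X ×_Y Y_i)_red → Y_i is an isomorphism of schemes for every i ∈ {1, …, r}. -/
open CategoryTheory AlgebraicGeometry CategoryTheory.Limits

/-- A morphism of schemes is a universal homeomorphism if every base change of it
is a homeomorphism on underlying topological spaces. -/
def IsUniversalHomeomorphism {X Y : Scheme} (f : X ⟶ Y) : Prop :=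
  (AlgebraicGeometry.topologically @IsHomeomorph).universally f

open TopologicalSpace Topology

universe u

namespace AlgebraicGeometry

instance universallyInjective_pullback_snd {X Y S : Scheme.{u}} (f : X ⟶ S) (g : Y ⟶ S)
    [UniversallyInjective f] : UniversallyInjective (pullback.snd f g) :=
  UniversallyInjective.isStableUnderBaseChange.of_isPullback
    (IsPullback.of_hasPullback f g) inferInstance

instance isSchemeTheoreticallyDominant_toImage {X Y : Scheme.{u}} (f : X ⟶ Y) [QuasiCompact f] :
    IsSchemeTheoreticallyDominant f.toImage where
  ker_eq_bot := by
    refine Scheme.IdealSheafData.ext_of_iSup_eq_top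
      (fun U : Y.affineOpens ↦ ⟨f.imageι ⁻¹ᵁ U.1, U.2.preimage f.imageι⟩) ?_ fun U ↦ ?_
    · rw [← Scheme.Hom.preimage_iSup, iSup_affineOpens_eq_top, Scheme.Hom.preimage_top]
    · rw [Scheme.Hom.ker_apply, Scheme.IdealSheafData.ideal_bot, Pi.bot_apply]
      exact (RingHom.injective_iff_ker_eq_bot _).mp (f.toImage_app_injective U)

lemma exists_section_of_universallyInjective_of_charZero {K : Type u} [Field K] [CharZero K]
    {P : Scheme.{u}} (p : P ⟶ Spec (.of K)) [UniversallyInjective p] [Surjective p] :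
    ∃ s : Spec (.of K) ⟶ P, s ≫ p = 𝟙 _ := by
  obtain ⟨x, -⟩ := p.surjective (IsLocalRing.closedPoint K)
  let h : Spec (P.residueField x) ⟶ Spec (.of K) := P.fromSpecResidueField x ≫ p
  obtain ⟨φ, hφ⟩ : ∃ φ, Spec.map φ = h := ⟨Spec.preimage h, Spec.map_preimage h⟩
  have hinj : UniversallyInjective (Spec.map φ) :=
    hφ ▸ MorphismProperty.comp_mem _ _ _ inferInstance inferInstance
  algebraize [φ.hom]
  have : IsPurelyInseparable K (P.residueField x) := by
    rw [isPurelyInseparable_iff_subsingleton_emb, subsingleton_iff]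
    intro σ₁ σ₂
    apply AlgHom.coe_ringHom_injective
    have inj_points : ∀ (L : Type u) [Field L],
        Function.Injective fun g : Spec (.of L) ⟶ _ ↦ g ≫ Spec.map φ :=
      ((tfae_universallyInjective (Spec.map φ)).out 0 1).mp hinj
    have := inj_points (AlgebraicClosure (P.residueField x))
      (show Spec.map (CommRingCat.ofHom σ₁.toRingHom) ≫ _ =
        Spec.map (CommRingCat.ofHom σ₂.toRingHom) ≫ _ by
        simp only [← Spec.map_comp]
        congr 1
        ext a
        exact (AlgHom.commutes σ₁ a).trans (AlgHom.commutes σ₂ a).symm)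
    exact congrArg CommRingCat.Hom.hom (Spec.map_injective this)
  let e := RingEquiv.ofBijective φ.hom
    (IsPurelyInseparable.bijective_algebraMap_of_isSeparable K (P.residueField x))
  refine ⟨Spec.map (CommRingCat.ofHom e.symm.toRingHom) ≫ P.fromSpecResidueField x, ?_⟩
  rw [Category.assoc]
  change _ ≫ h = _
  rw [← hφ, ← Spec.map_comp, ← Spec.map_id]
  congr 1
  ext a
  exact e.symm_apply_apply a

lemma exists_local_section_of_universallyInjective {P Z : Scheme.{u}} (p : P ⟶ Z) [IsIntegral Z]
    [CharZero Z.functionField] [UniversallyInjective p] [Surjective p] [LocallyOfFiniteType p] :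
    ∃ (U : Z.Opens) (s : U.toScheme ⟶ P), genericPoint Z ∈ U ∧ s ≫ p = U.ι := by
  let i : Spec (.of Z.functionField) ⟶ Z := Z.fromSpecStalk (genericPoint Z)
  obtain ⟨t, ht⟩ := exists_section_of_universallyInjective_of_charZero (pullback.snd p i)
  obtain ⟨U, hU, s, -, hs⟩ := spread_out_of_isGermInjective' (x := genericPoint Z) (𝟙 Z) p
    (t ≫ pullback.fst p i) (by
      rw [Category.assoc, pullback.condition, reassoc_of% ht, Category.comp_id])
  exact ⟨U, s, hU, by simpa using hs⟩

lemma isClosedImmersion_and_surjective_of_section {T P : Scheme.{u}} (ι : T ⟶ P) (p : P ⟶ T)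
    [UniversallyInjective p] (h : ι ≫ p = 𝟙 T) : IsClosedImmersion ι ∧ Surjective ι := by
  have hs : Function.Surjective ι := fun x ↦
    ⟨p x, p.injective (by rw [← Scheme.Hom.comp_apply, h]; rfl)⟩
  have : IsImmersion (ι ≫ p) := h ▸ inferInstance
  have : IsImmersion ι := .of_comp ι p
  exact ⟨.of_isPreimmersion _ (by rw [hs.range_eq]; exact isClosed_univ), ⟨hs⟩⟩

lemma exists_isIntegral_range_eq_closure (Y : Scheme.{u}) [IsNoetherian Y] (y : Y) :
    ∃ (Z : Scheme.{u}) (j : Z ⟶ Y), IsIntegral Z ∧ IsClosedImmersion j ∧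
      Set.range j = closure {y} := by
  let g := Y.fromSpecResidueField y
  have : IsReduced g.image := IsSchemeTheoreticallyDominant.isReduced g.toImage
  have : IrreducibleSpace g.image := by
    have := ((IrreducibleSpace.isIrreducible_univ (Spec (Y.residueField y))).image g.toImage
      g.toImage.continuous.continuousOn).closure
    rw [Set.image_univ, g.toImage.denseRange.closure_range] at this
    exact irreducibleSpace_def _ |>.mpr this
  refine ⟨g.image, g.imageι, isIntegral_of_irreducibleSpace_of_isReduced _, inferInstance, ?_⟩
  simp [Scheme.IdealSheafData.range_subschemeι, Scheme.Hom.support_ker, g,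
    Scheme.range_fromSpecResidueField]

/-- The projection `(X ×_Y S)_red ⟶ S` is an isomorphism, where `S` carries the reduced induced
subscheme structure. -/
def IsReducedIsoOver {X Y : Scheme.{u}} (f : X ⟶ Y) (S : Set Y) : Prop :=
  ∃ (Yi T : Scheme) (ji : Yi ⟶ Y) (ι : T ⟶ pullback f ji),
    IsReduced Yi ∧ IsImmersion ji ∧ Set.range ji.base = S ∧
    IsReduced T ∧ IsClosedImmersion ι ∧ Function.Surjective ι.base ∧
    IsIso (ι ≫ pullback.snd f ji)

lemma exists_isReducedIsoOver {X Y : Scheme.{0}} (f : X ⟶ Y) [IsNoetherian Y]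
    (sY : Y ⟶ Spec (.of ℚ))
    [UniversallyInjective f] [Surjective f] [LocallyOfFiniteType f]
    (y : Y) (W : Y.Opens) (hy : y ∈ W) :
    ∃ V : Y.Opens, y ∈ V ∧ V ≤ W ∧ IsReducedIsoOver f (closure {y} ∩ V) := by
  obtain ⟨Z, j, _, _, hj⟩ := exists_isIntegral_range_eq_closure Y y
  have : CharZero Z.functionField :=
    charZero_of_injective_ringHom
      (Spec.preimage (Z.fromSpecStalk (genericPoint Z) ≫ j ≫ sY)).hom.injective
  obtain ⟨U, s, hU, hs⟩ := exists_local_section_of_universallyInjective (pullback.snd f j)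
  have hgen : j (genericPoint Z) = y := by
    have := (genericPoint_spec Z).image j.continuous
    rw [Set.image_univ, hj, closure_closure] at this
    exact this.eq isGenericPoint_closure
  obtain ⟨V, hV, hVU⟩ := j.isEmbedding.isInducing.isOpen_iff.mp U.isOpen
  let V : Y.Opens := ⟨V, hV⟩
  let U' : Z.Opens := j ⁻¹ᵁ (V ⊓ W)
  have hU' : U' ≤ U := fun x hx ↦ hVU.le hx.1
  refine ⟨V ⊓ W, ⟨?_, hy⟩, inf_le_right, U', U', U'.ι ≫ j,
    pullback.lift (Z.homOfLE hU' ≫ s ≫ pullback.fst f j) (𝟙 _) ?_,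
    inferInstance, inferInstance, ?_, inferInstance, ?_⟩
  · have : genericPoint Z ∈ j ⁻¹' V := hVU.ge hU
    rwa [← hgen]
  · simp [pullback.condition, reassoc_of% hs]
  · rw [← hj]
    simp only [Set.range_comp, U', Scheme.Hom.comp_base, TopCat.coe_comp, Scheme.Opens.range_ι]
    exact Set.image_preimage_eq_range_inter (f := j) (t := (V ⊓ W : Y.Opens))
  · have := isClosedImmersion_and_surjective_of_section
      (pullback.lift (Z.homOfLE hU' ≫ s ≫ pullback.fst f j) (𝟙 _)
        (by simp [pullback.condition, reassoc_of% hs]))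
      (pullback.snd f (U'.ι ≫ j)) (pullback.lift_snd _ _ _)
    exact ⟨this.1, this.2.surj, by rw [pullback.lift_snd]; infer_instance⟩

lemma exists_partition {Y : Type*} [TopologicalSpace Y] [NoetherianSpace Y] [QuasiSober Y]
    (P : Set Y → Prop)
    (hP : ∀ (y : Y) (W : Set Y), IsOpen W → y ∈ W →
      ∃ V : Set Y, IsOpen V ∧ y ∈ V ∧ V ⊆ W ∧ P (closure {y} ∩ V)) (C : Closeds Y) :
    ∃ (r : ℕ) (S : Fin r → Set Y), (∀ i, IsLocallyClosed (S i)) ∧ (⋃ i, S i) = C ∧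
      (∀ i j, i ≠ j → Disjoint (S i) (S j)) ∧ ∀ i, P (S i) := by
  induction C using (wellFounded_lt (α := Closeds Y)).induction with
  | _ C ih
  obtain hC | ⟨⟨x, hx⟩⟩ := (C : Set Y).eq_empty_or_nonempty.imp_right Set.Nonempty.to_subtype
  · exact ⟨0, Fin.elim0, by simp, by simp [hC], by simp, by simp⟩
  have : NoetherianSpace C := IsInducing.subtypeVal.noetherianSpace
  have : QuasiSober C := C.isClosed.isClosedEmbedding_subtypeVal.quasiSober
  let c : C := ⟨x, hx⟩
  obtain ⟨_, ⟨W, hW, rfl⟩, ⟨z, hz⟩, hWc⟩ :=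
    NoetherianSpace.exists_isOpen_nonempty_subset_irreducibleComponent
      (irreducibleComponent c) (irreducibleComponent_mem_irreducibleComponents c)
  obtain ⟨w, hw⟩ := QuasiSober.sober (isIrreducible_irreducibleComponent (x := c))
    isClosed_irreducibleComponent
  have hspec (p : C) (hp : p.1 ∈ W) : w.1 ⤳ p.1 :=
    (hw.specializes (hWc hp)).map continuous_subtype_val
  obtain ⟨V, hV, hwV, hVW, hPV⟩ := hP w.1 W hW ((hspec z hz).mem_open hW hz)
  have hCV : closure {w.1} ∩ V = (C : Set Y) ∩ V := by
    refine subset_antisymm (Set.inter_subset_inter_left _ ?_) fun p hp ↦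
      ⟨(hspec ⟨p, hp.1⟩ (hVW hp.2)).mem_closure, hp.2⟩
    exact closure_minimal (by simp) C.isClosed
  rw [hCV] at hPV
  let D : Closeds Y := ⟨C \ V, C.isClosed.sdiff hV⟩
  have hD : D < C := SetLike.lt_iff_le_and_exists.mpr
    ⟨fun _ h ↦ h.1, w.1, w.2, fun h ↦ h.2 hwV⟩
  obtain ⟨r, S, hS, hSD, hSS, hPS⟩ := ih D hD
  have hdisj (i) : Disjoint (C ∩ V : Set Y) (S i) :=
    Set.disjoint_left.mpr fun p hp hpi ↦ (hSD.le (Set.mem_iUnion_of_mem i hpi)).2 hp.2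
  refine ⟨r + 1, Fin.cons ((C : Set Y) ∩ V) S, ?_, ?_, ?_, ?_⟩
  · exact Fin.cases (C.isClosed.isLocallyClosed.inter hV.isLocallyClosed) hS
  · ext p
    rw [Set.mem_iUnion, Fin.exists_fin_succ]
    simp only [Fin.cons_zero, Fin.cons_succ, ← Set.mem_iUnion, hSD]
    exact Set.ext_iff.mp (Set.inter_union_sdiff _ _) p
  · refine Fin.cases (Fin.cases (by simp) fun i _ ↦ hdisj i)
      fun i ↦ Fin.cases (fun _ ↦ (hdisj i).symm) fun j hij ↦ hSS i j (by simpa using hij)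
  · exact Fin.cases hPV hPS

end AlgebraicGeometry

/-- a finite-type universal homeomorphism between Noetherian `ℚ`-schemes
is a piecewise isomorphism: there is a finite partition of `Y` into locally closed
subsets `S i` such that, taking `Yᵢ` the reduced induced subscheme on `S i` (a reduced
scheme with an immersion to `Y` with image `S i`) and `T` the maximal reduced closed
subscheme of `X ×_Y Yᵢ` (a reduced scheme with a surjective closed immersion into the
fibre product), the induced morphism `T = (X ×_Y Yᵢ)_red ⟶ Yᵢ` is an isomorphism. -/
theorem statement0 (X Y : Scheme)
    [IsNoetherian X] [IsNoetherian Y]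
    (sX : X ⟶ Spec (CommRingCat.of ℚ)) (sY : Y ⟶ Spec (CommRingCat.of ℚ))
    (f : X ⟶ Y) (hf : f ≫ sY = sX)
    [LocallyOfFiniteType f] [QuasiCompact f]
    (huniv : IsUniversalHomeomorphism f) :
    ∃ (r : ℕ) (S : Fin r → Set Y),
      (∀ i, IsLocallyClosed (S i)) ∧
      (⋃ i, S i) = Set.univ ∧
      (∀ i j, i ≠ j → Disjoint (S i) (S j)) ∧
      (∀ i, ∃ (Yi T : Scheme) (ji : Yi ⟶ Y) (ι : T ⟶ pullback f ji),
        IsReduced Yi ∧ IsImmersion ji ∧ Set.range ji.base = S i ∧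
        IsReduced T ∧ IsClosedImmersion ι ∧ Function.Surjective ι.base ∧
        IsIso (ι ≫ pullback.snd f ji)) := by
  have : UniversallyInjective f := ⟨MorphismProperty.universally_mono
    (fun _ _ _ h ↦ h.injective) _ huniv⟩
  have : Surjective f := ⟨(huniv _ _ _ .of_id_snd).surjective⟩
  obtain ⟨r, S, hS, hSY, hSS, hPS⟩ := exists_partition (IsReducedIsoOver f)
    (fun y W hW hy ↦
      let ⟨V, hyV, hVW, hV⟩ := exists_isReducedIsoOver f sY y ⟨W, hW⟩ hy
      ⟨V, V.isOpen, hyV, hVW, hV⟩) ⊤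
  exact ⟨r, S, hS, hSY, hSS, hPS⟩
end

section
/- Let f : X → Y be a universal homeomorphism of finite type between integral (i.e., reduced and irreducible) Noetherian schemes over ℚ. Then there exists a nonempty open subscheme U of Y such that the base change morphism X ×_Y U → U is an isomorphism of schemes. -/
open CategoryTheory AlgebraicGeometry CategoryTheory.Limits

namespace AlgebraicGeometry

universe u

/-- A universally injective morphism is an isomorphism on the stalks at a point where both stalks
are fields, provided the residue field of the image has characteristic zero. -/
theorem isIso_stalkMap_of_universallyInjective {X Y : Scheme.{u}} (f : X ⟶ Y)
    [UniversallyInjective f] (x : X) (hx : IsField (X.presheaf.stalk x))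
    (hy : IsField (Y.presheaf.stalk (f x))) [CharZero (Y.residueField (f x))] :
    IsIso (f.stalkMap x) := by
  have hres {Z : Scheme.{u}} {z : Z} (hz : IsField (Z.presheaf.stalk z)) :
      IsIso (Z.residue z) := by
    let := hz.toField
    rw [ConcreteCategory.isIso_iff_bijective]
    exact ⟨(Z.residue z).hom.injective, Z.residue_surjective z⟩
  have := hres hx
  have := hres hy
  have hrad : UniversallyInjective f ↔
      Function.Injective f ∧ ∀ x, (f.residueFieldMap x).hom.IsPurelyInseparable :=
    (tfae_universallyInjective f).out 0 2
  have hpi := (hrad.mp ‹_›).2 x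
  have : IsIso (f.residueFieldMap x) := by
    rw [ConcreteCategory.isIso_iff_bijective]
    algebraize [(f.residueFieldMap x).hom]
    exact IsPurelyInseparable.bijective_algebraMap_of_isSeparable
      (Y.residueField (f x)) (X.residueField x)
  have : IsIso (f.stalkMap x ≫ X.residue x) := by
    rw [← Scheme.residue_residueFieldMap]
    infer_instance
  exact IsIso.of_isIso_comp_right _ (X.residue x)

/-- A scheme over `ℚ` has residue fields of characteristic zero. -/
theorem charZero_residueField_of_hom_Spec_rat {Y : Scheme.{0}} (sY : Y ⟶ Spec (.of ℚ)) (y : Y) :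
    CharZero (Y.residueField y) :=
  charZero_of_injective_ringHom
    (Spec.preimage (Y.fromSpecResidueField y ≫ sY)).hom.injective

/-- The stalk of an integral scheme at a generic point is a field. -/
theorem isField_stalk_of_isGenericPoint {X : Scheme.{u}} [IsIntegral X] {x : X}
    (hx : IsGenericPoint x Set.univ) : IsField (X.presheaf.stalk x) :=
  isField_stalk_of_closure_mem_irreducibleComponents X x
    (by simp [irreducibleComponents_eq_singleton, hx.def])

/-- If a morphism locally of finite type to an integral scheme induces an isomorphism on stalks
at a point `x`, then it has a section over a neighbourhood of the image of `x`. -/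
theorem exists_section_of_isIso_stalkMap {X Y : Scheme.{u}} [IsIntegral Y] (f : X ⟶ Y)
    [LocallyOfFiniteType f] (x : X) [IsIso (f.stalkMap x)] :
    ∃ (U : Y.Opens) (s : U.toScheme ⟶ X), f x ∈ U ∧ s ≫ f = U.ι := by
  obtain ⟨U, hU, s, -, hs⟩ := spread_out_of_isGermInjective' (𝟙 Y) f
    (Spec.map (inv (f.stalkMap x)) ≫ X.fromSpecStalk x) (by
      rw [Category.assoc, ← Scheme.SpecMap_stalkMap_fromSpecStalk, ← Spec.map_comp_assoc]
      simp)
  exact ⟨U, s, hU, by simpa using hs⟩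

/-- An injective morphism from a reduced scheme which has a section is an isomorphism. -/
theorem isIso_of_section_of_injective {X Y : Scheme.{u}} [IsReduced X] (f : X ⟶ Y)
    (hf : Function.Injective f) (s : Y ⟶ X) (hs : s ≫ f = 𝟙 Y) : IsIso f := by
  have : IsImmersion (s ≫ f) := hs ▸ inferInstance
  have : IsImmersion s := .of_comp s f
  have hsurj : Function.Surjective s := fun x ↦
    ⟨f x, hf (by rw [← Scheme.Hom.comp_apply, hs]; rfl)⟩
  have : Surjective s := ⟨hsurj⟩
  have : IsClosedImmersion s := .of_isPreimmersion s (by simp [hsurj.range_eq])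
  have : IsIso s := isIso_of_isClosedImmersion_of_surjective s
  have : IsIso (s ≫ f) := hs ▸ inferInstance
  exact IsIso.of_isIso_comp_left s f

end AlgebraicGeometry

theorem IsUniversalHomeomorphism.universallyInjective {X Y : Scheme} {f : X ⟶ Y}
    (hf : IsUniversalHomeomorphism f) : UniversallyInjective f :=
  ⟨fun _ _ i₁ i₂ f' h ↦ (hf i₁ i₂ f' h : IsHomeomorph f').injective⟩

theorem IsUniversalHomeomorphism.isHomeomorph {X Y : Scheme} {f : X ⟶ Y}
    (hf : IsUniversalHomeomorphism f) : IsHomeomorph f :=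
  MorphismProperty.universally_le _ _ hf

/-- a finite-type universal homeomorphism between integral Noetherian
`ℚ`-schemes is an isomorphism over some nonempty open subscheme `U` of the target,
i.e. the base change `X ×_Y U ⟶ U` is an isomorphism of schemes. -/
theorem statement1 (X Y : Scheme)
    [IsNoetherian X] [IsNoetherian Y] [IsIntegral X] [IsIntegral Y]
    (sX : X ⟶ Spec (CommRingCat.of ℚ)) (sY : Y ⟶ Spec (CommRingCat.of ℚ))
    (f : X ⟶ Y) (hf : f ≫ sY = sX)
    [LocallyOfFiniteType f] [QuasiCompact f]
    (huniv : IsUniversalHomeomorphism f) :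
    ∃ U : Y.Opens, (U : Set Y).Nonempty ∧ IsIso (pullback.snd f U.ι) := by
  have := huniv.universallyInjective
  let ξ := genericPoint X
  have hξ : IsGenericPoint (f ξ) (Set.univ : Set Y) := by
    simpa [huniv.isHomeomorph.surjective.range_eq] using
      (genericPoint_spec X).image f.continuous
  have := charZero_residueField_of_hom_Spec_rat sY (f ξ)
  have := isIso_stalkMap_of_universallyInjective f ξ
    (isField_stalk_of_isGenericPoint (genericPoint_spec X)) (isField_stalk_of_isGenericPoint hξ)
  obtain ⟨U, s, hU, hs⟩ := exists_section_of_isIso_stalkMap f ξ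
  have hinj : Function.Injective (pullback.snd f U.ι) :=
    (huniv _ _ _ (IsPullback.of_hasPullback f U.ι).flip : IsHomeomorph _).injective
  have : IsReduced (pullback f U.ι) := isReduced_of_isOpenImmersion (pullback.fst f U.ι)
  exact ⟨U, ⟨f ξ, hU⟩, isIso_of_section_of_injective _ hinj
    (pullback.lift s (𝟙 _) (by simpa using hs)) (pullback.lift_snd _ _ _)⟩
end

section
/- Let f : X → Y be a universal homeomorphism of finite type between integral Noetherian schemes over ℚ, with generic points η_X of X and η_Y of Y. Then f maps η_X to η_Y, and the induced extension of residue fields κ(η_Y) → κ(η_X) is an isomorphism; consequently the restriction of f to some dense open subscheme of X is an open immersion. -/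
open CategoryTheory AlgebraicGeometry CategoryTheory.Limits

namespace AlgebraicGeometry

universe u

variable {X Y : Scheme.{u}}

/-- A morphism that is locally of finite presentation and induces an isomorphism on the local
rings at `x` is étale in a neighbourhood of `x`. -/
lemma exists_etale_of_isIso_stalkMap (f : X ⟶ Y) [LocallyOfFinitePresentation f] (x : X)
    [IsIso (f.stalkMap x)] : ∃ V : X.Opens, x ∈ V ∧ Etale (V.ι ≫ f) := by
  obtain ⟨_, ⟨U, hU, rfl⟩, hxU, -⟩ :=
    Y.isBasis_affineOpens.exists_subset_of_mem_open (Set.mem_univ (f x)) isOpen_univ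
  obtain ⟨_, ⟨V, hV, rfl⟩, hxV, hVU⟩ :=
    X.isBasis_affineOpens.exists_subset_of_mem_open hxU (U.2.preimage f.continuous)
  replace hU : IsAffineOpen U := hU
  replace hV : IsAffineOpen V := hV
  have := f.finitePresentation_appLE hU hV hVU
  algebraize [(f.appLE U V hVU).hom]
  let p := (hU.primeIdealOf ⟨f x, hVU hxV⟩).asIdeal
  let q := (hV.primeIdealOf ⟨x, hxV⟩).asIdeal
  have : q.LiesOver p :=
    ⟨congr($(IsAffineOpen.comap_primeIdealOf_appLE U hU V hV hVU hxV).1).symm⟩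
  let := Localization.AtPrime.algebraOfLiesOver p q
  have hpq : Function.Bijective
      (algebraMap (Localization.AtPrime p) (Localization.AtPrime q)) := by
    have := ((MorphismProperty.isomorphisms CommRingCat).arrow_mk_iso_iff
      (IsAffineOpen.arrowStalkMapIso f U hU V hV hVU hxV)).mp
      (MorphismProperty.isomorphisms.infer_property (f.stalkMap x))
    exact (ConcreteCategory.isIso_iff_bijective _).mp this
  have : Algebra.FormallyEtale (Localization.AtPrime p) (Localization.AtPrime q) :=
    .of_equiv (.ofBijective (Algebra.ofId _ _) hpq)
  have : Algebra.IsEtaleAt Γ(Y, U) q :=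
    Algebra.FormallyEtale.comp Γ(Y, U) (Localization.AtPrime p) (Localization.AtPrime q)
  obtain ⟨r, hrx, hr⟩ := Algebra.exists_etale_of_isEtaleAt (R := Γ(Y, U)) q
  have hrU : X.basicOpen r ≤ f ⁻¹ᵁ U := (X.basicOpen_le r).trans hVU
  refine ⟨X.basicOpen r, ?_, ?_⟩
  · have hx : hV.primeIdealOf ⟨x, hxV⟩ ∈ hV.fromSpec ⁻¹ᵁ X.basicOpen r := by
      rw [hV.fromSpec_preimage_basicOpen]
      exact hrx
    change hV.fromSpec (hV.primeIdealOf ⟨x, hxV⟩) ∈ X.basicOpen r at hx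
    rwa [hV.fromSpec_primeIdealOf] at hx
  · have hloc := hV.isLocalization_basicOpen r
    have hf : (f.appLE U (X.basicOpen r) hrU).hom.Etale := by
      algebraize [(f.appLE U (X.basicOpen r) hrU).hom]
      have : IsScalarTower Γ(Y, U) Γ(X, V) Γ(X, X.basicOpen r) :=
        .of_algebraMap_eq' congr(($(f.appLE_map hVU (homOfLE (X.basicOpen_le r)).op)).hom).symm
      exact Algebra.Etale.of_equiv
        ((IsLocalization.algEquiv (.powers r) (Localization.Away r)
          Γ(X, X.basicOpen r)).restrictScalars Γ(Y, U))
    have : Etale (Spec.map (f.appLE U (X.basicOpen r) hrU)) :=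
      (HasRingHomProperty.Spec_iff (P := @Etale)).mpr hf
    have e : (X.basicOpen r).ι ≫ f = (hV.basicOpen r).isoSpec.hom ≫
        Spec.map (f.appLE U (X.basicOpen r) hrU) ≫ hU.fromSpec := by
      rw [IsAffineOpen.SpecMap_appLE_fromSpec f hU (hV.basicOpen r), ← Iso.inv_comp_eq,
        IsAffineOpen.isoSpec_inv_ι_assoc]
    have := hU.isOpenImmersion_fromSpec
    rw [e]
    infer_instance

/-- Étale universally injective morphisms are open immersions. -/
lemma IsOpenImmersion.of_etale_of_universallyInjective (f : X ⟶ Y) [Etale f]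
    [UniversallyInjective f] : IsOpenImmersion f := by
  have : Surjective (pullback.diagonal f) := (UniversallyInjective.iff_diagonal f).mp ‹_›
  have : IsIso (pullback.diagonal f) :=
    (isIso_iff_isOpenImmersion_and_surjective _).mpr ⟨inferInstance, this⟩
  have : Mono f := (pullback.isIso_diagonal_iff f).mp this
  exact .of_flat_of_mono f

/-- A universally injective morphism induces isomorphisms on residue fields of characteristic
zero. -/
lemma isIso_residueFieldMap_of_charZero (f : X ⟶ Y) [UniversallyInjective f] (x : X)
    [CharZero (Y.residueField (f x))] : IsIso (f.residueFieldMap x) := by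
  have h : (f.residueFieldMap x).hom.IsPurelyInseparable :=
    (((tfae_universallyInjective f).out 0 2 rfl rfl).mp ‹_›).2 x
  algebraize [(f.residueFieldMap x).hom]
  have : Function.Bijective (f.residueFieldMap x).hom :=
    IsPurelyInseparable.bijective_algebraMap_of_isSeparable (Y.residueField (f x))
      (X.residueField x)
  exact (ConcreteCategory.isIso_iff_bijective (f.residueFieldMap x)).mpr this

/-- A surjective morphism maps the generic point to the generic point. -/
lemma map_genericPoint_of_surjective [IrreducibleSpace X] [IrreducibleSpace Y] (f : X ⟶ Y)
    [Surjective f] : f (genericPoint X) = genericPoint Y := by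
  refine IsGenericPoint.eq ?_ (genericPoint_spec Y)
  have := (genericPoint_spec X).image f.continuous
  rwa [Set.image_univ, f.surjective.range_eq, closure_univ] at this

lemma isIso_residue_genericPoint (X : Scheme.{u}) [IsIntegral X] :
    IsIso (X.residue (genericPoint X)) := by
  refine (ConcreteCategory.isIso_iff_bijective _).mpr
    ⟨RingHom.injective (R := X.functionField) (X.residue (genericPoint X)).hom,
      X.residue_surjective _⟩

lemma isIso_stalkMap_genericPoint [IsIntegral X] [IsIntegral Y] (f : X ⟶ Y)
    (hf : f (genericPoint X) = genericPoint Y) [IsIso (f.residueFieldMap (genericPoint X))] :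
    IsIso (f.stalkMap (genericPoint X)) := by
  have := isIso_residue_genericPoint X
  have : IsIso (Y.residue (f (genericPoint X))) := hf ▸ isIso_residue_genericPoint Y
  have : IsIso (f.stalkMap (genericPoint X) ≫ X.residue (genericPoint X)) := by
    rw [← Scheme.residue_residueFieldMap]
    infer_instance
  exact IsIso.of_isIso_comp_right _ (X.residue (genericPoint X))

end AlgebraicGeometry

/-- a finite-type universal homeomorphism `f : X ⟶ Y` between integral
Noetherian `ℚ`-schemes maps the generic point of `X` to the generic point of `Y`,
induces an isomorphism on the residue fields of the generic points, and restricts to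
an open immersion on some dense open subscheme of `X`. -/
theorem statement2 (X Y : Scheme)
    [IsNoetherian X] [IsNoetherian Y] [IsIntegral X] [IsIntegral Y]
    (sX : X ⟶ Spec (CommRingCat.of ℚ)) (sY : Y ⟶ Spec (CommRingCat.of ℚ))
    (f : X ⟶ Y) (hf : f ≫ sY = sX)
    [LocallyOfFiniteType f] [QuasiCompact f]
    (huniv : IsUniversalHomeomorphism f) :
    f.base (genericPoint X) = genericPoint Y ∧
    IsIso (f.residueFieldMap (genericPoint X)) ∧
    ∃ U : X.Opens, Dense (U : Set X) ∧ IsOpenImmersion (U.ι ≫ f) := by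
  have : UniversallyInjective f :=
    ⟨MorphismProperty.universally_mono (fun _ _ _ h ↦ IsHomeomorph.injective h) f huniv⟩
  have : Surjective f := ⟨(MorphismProperty.universally_le _ f huniv).surjective⟩
  have hgen := map_genericPoint_of_surjective f
  have : CharZero (Y.residueField (f (genericPoint X))) :=
    charZero_of_injective_ringHom (R := ℚ)
      (Spec.preimage (Y.fromSpecResidueField (f (genericPoint X)) ≫ sY)).hom.injective
  have hres := isIso_residueFieldMap_of_charZero f (genericPoint X)
  have := isIso_stalkMap_genericPoint f hgen
  obtain ⟨U, hxU, hU⟩ := exists_etale_of_isIso_stalkMap f (genericPoint X)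
  have : UniversallyInjective (U.ι ≫ f) := MorphismProperty.comp_mem _ _ _ inferInstance ‹_›
  exact ⟨hgen, hres, U, U.isOpen.dense ⟨_, hxU⟩, .of_etale_of_universallyInjective _⟩
end

section
/- Let F be a field, let m and n be natural numbers, let C be a nonempty constructible subset of the affine space 𝔸^m_F, and let E be a constructible subset of 𝔸^{m+n}_F. Let π : 𝔸^{m+n}_F → 𝔸^m_F denote the projection onto the first m coordinates. Assume that for every algebraically closed field L containing F, the subset E(L) of L^{m+n} is the graph of a function whose domain of definition is C(L) ⊆ L^m (i.e., the projection L^{m+n} → L^m maps E(L) into C(L), and for every point c ∈ C(L) there is exactly one point of E(L) lying over c). Then there exists a nonempty subset U of C which is open in C and locally closed in 𝔸^m_F, such that V := E ∩ π^{-1}(U) is locally closed in 𝔸^{m+n}_F and the morphism V → U induced by π, where U and V are endowed with their reduced induced subscheme structures, is a universal homeomorphism. -/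
open CategoryTheory AlgebraicGeometry CategoryTheory.Limits

/-- A constructible subset of a topological space: a finite union of locally
closed subsets. -/
def IsConstructibleSet {α : Type*} [TopologicalSpace α] (s : Set α) : Prop :=
  ∃ (k : ℕ) (t : Fin k → Set α), (∀ i, IsLocallyClosed (t i)) ∧ s = ⋃ i, t i

/-- Affine `r`-space over the field `F`, as the spectrum of a polynomial ring. -/
noncomputable abbrev AffSp (F : Type) [Field F] (r : ℕ) : Scheme :=
  Spec (CommRingCat.of (MvPolynomial (Fin r) F))

/-- The projection `𝔸^{m+n}_F ⟶ 𝔸^m_F` onto the first `m` coordinates. -/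
noncomputable def projAff (F : Type) [Field F] (m n : ℕ) :
    AffSp F (m + n) ⟶ AffSp F m :=
  Spec.map (CommRingCat.ofHom
    (MvPolynomial.rename (Fin.castAdd n) : MvPolynomial (Fin m) F →ₐ[F] _).toRingHom)

/-- The point of affine `r`-space over `F` corresponding to the coordinate tuple
`a : Fin r → L`, for `L` a field extension of `F`: the image of the induced morphism
`Spec L ⟶ 𝔸^r_F`, i.e. the kernel of the evaluation map at `a`. -/
noncomputable def ptOf (F : Type) [Field F] (r : ℕ) (L : Type) [Field L] [Algebra F L]
    (a : Fin r → L) : AffSp F r :=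
  (⟨RingHom.ker (MvPolynomial.aeval a).toRingHom,
    RingHom.ker_isPrime _⟩ : PrimeSpectrum (MvPolynomial (Fin r) F))

/-- `D(L)`: the set of tuples `a ∈ L^r` whose associated point of `𝔸^r_F` lies in `D`. -/
noncomputable def Lpoints (F : Type) [Field F] (r : ℕ) (D : Set (AffSp F r))
    (L : Type) [Field L] [Algebra F L] : Set (Fin r → L) :=
  {a | ptOf F r L a ∈ D}

open TopologicalSpace in
theorem IsConstructibleSet.isConstructible {X : Type*} [TopologicalSpace X] [NoetherianSpace X]
    {s : Set X} (hs : IsConstructibleSet s) : Topology.IsConstructible s := by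
  have hopen (O : Set X) (hO : IsOpen O) : Topology.IsConstructible O :=
    IsRetrocompact.isConstructible hO fun _ _ _ ↦ NoetherianSpace.isCompact _
  obtain ⟨k, t, ht, rfl⟩ := hs
  refine Topology.IsConstructible.iUnion fun i ↦ ?_
  obtain ⟨O, Z, hO, hZ, h⟩ := ht i
  rw [h]
  exact (hopen O hO).inter (hopen _ hZ.isOpen_compl).of_compl

namespace Topology.IsConstructible

variable {X : Type*} [TopologicalSpace X] {s : Set X}

/-- A constructible set either contains or misses a neighbourhood of `x` in the closure of `x`. -/
theorem exists_isOpen_inter_closure (hs : IsConstructible s) (x : X) :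
    ∃ O : Set X, IsOpen O ∧ x ∈ O ∧
      (O ∩ closure {x} ⊆ s ∨ Disjoint (O ∩ closure {x}) s) := by
  induction hs using IsConstructible.empty_union_induction with
  | open_retrocompact U hU _ =>
    by_cases hx : x ∈ U
    · exact ⟨U, hU, hx, .inl Set.inter_subset_left⟩
    · refine ⟨Set.univ, isOpen_univ, trivial, .inr ?_⟩
      rw [Set.univ_inter]
      refine Set.disjoint_left.mpr fun y hy hyU ↦ hx ?_
      exact (specializes_iff_mem_closure.mpr hy).mem_open hU hyU
  | union s hs t ht ihs iht =>
    obtain ⟨O₁, hO₁, hx₁, h₁⟩ := ihs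
    obtain ⟨O₂, hO₂, hx₂, h₂⟩ := iht
    refine ⟨O₁ ∩ O₂, hO₁.inter hO₂, ⟨hx₁, hx₂⟩, ?_⟩
    simp only [Set.disjoint_left, Set.subset_def] at *
    grind
  | compl s hs ih =>
    obtain ⟨O, hO, hx, h⟩ := ih
    exact ⟨O, hO, hx, h.symm.imp Disjoint.subset_compl_right
      Set.disjoint_compl_right_iff_subset.mpr⟩

theorem exists_isOpen_inter_closure_subset (hs : IsConstructible s) {x : X} (hx : x ∈ s) :
    ∃ O : Set X, IsOpen O ∧ x ∈ O ∧ O ∩ closure {x} ⊆ s := by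
  obtain ⟨O, hO, hxO, h⟩ := hs.exists_isOpen_inter_closure x
  exact ⟨O, hO, hxO, h.resolve_right fun h ↦
    Set.disjoint_left.mp h ⟨hxO, subset_closure rfl⟩ hx⟩

open TopologicalSpace in
/-- A nonempty constructible set contains a generic point of one of its nonempty open subsets. -/
theorem exists_isOpen_inter_subset_closure [NoetherianSpace X] [QuasiSober X]
    (hs : IsConstructible s) (hne : s.Nonempty) :
    ∃ x ∈ s, ∃ O : Set X, IsOpen O ∧ x ∈ O ∧ O ∩ s ⊆ closure {x} := by
  obtain ⟨Z, ⟨O, hO, hOs, hOZ⟩, hmin⟩ := wellFounded_lt.has_min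
    {Z : Closeds X | ∃ O, IsOpen O ∧ (O ∩ s).Nonempty ∧ (Z : Set X) = closure (O ∩ s)}
    ⟨⟨closure (Set.univ ∩ s), isClosed_closure⟩, Set.univ, isOpen_univ, by simpa, rfl⟩
  have key (W : Set X) (hW : IsOpen W) (hWs : (O ∩ s ∩ W).Nonempty) :
      O ∩ s ⊆ closure (O ∩ s ∩ W) := by
    have h : ¬ (⟨closure (O ∩ s ∩ W), isClosed_closure⟩ : Closeds X) < Z :=
      hmin _ ⟨O ∩ W, hO.inter hW, by grind, congrArg closure (by grind)⟩
    have hle : (⟨closure (O ∩ s ∩ W), isClosed_closure⟩ : Closeds X) ≤ Z := by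
      change closure (O ∩ s ∩ W) ⊆ (Z : Set X)
      rw [hOZ]
      exact closure_mono Set.inter_subset_left
    have heq := (hle.lt_or_eq.resolve_left h)
    rw [← heq] at hOZ
    exact subset_closure.trans hOZ.symm.subset
  have hirr : IsIrreducible (O ∩ s) := by
    refine ⟨hOs, fun W₁ W₂ hW₁ hW₂ h₁ ⟨y, hy, hy₂⟩ ↦ ?_⟩
    obtain ⟨z, hz₂, hz⟩ := mem_closure_iff.mp (key W₁ hW₁ h₁ hy) W₂ hW₂ hy₂
    exact ⟨z, hz.1, hz.2, hz₂⟩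
  obtain ⟨x, hx⟩ := QuasiSober.sober hirr.closure isClosed_closure
  have hx : closure {x} = closure (O ∩ s) := hx
  have hxcl : x ∈ closure (O ∩ s) := hx ▸ subset_closure rfl
  have hxO : x ∈ O := by
    obtain ⟨y, hy⟩ := hOs
    have : y ∈ closure {x} := hx ▸ subset_closure hy
    exact (specializes_iff_mem_closure.mpr this).mem_open hO hy.1
  refine ⟨x, ?_, O, hO, hxO, hx ▸ subset_closure⟩
  obtain ⟨W, hW, hxW, h⟩ := hs.exists_isOpen_inter_closure x
  obtain ⟨z, hzW, hz⟩ := mem_closure_iff.mp hxcl W hW hxW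
  rcases h with h | h
  · exact h ⟨hxW, subset_closure rfl⟩
  · exact (Set.disjoint_left.mp h ⟨hzW, hx ▸ subset_closure hz⟩ hz.2).elim

end Topology.IsConstructible

theorem isUniversalHomeomorphism_of_isIntegralHom {X Y : Scheme} (f : X ⟶ Y) [IsIntegralHom f]
    [UniversallyInjective f] [Surjective f] : IsUniversalHomeomorphism f := by
  intro X' Y' i₁ i₂ f' h
  have : IsIntegralHom f' := MorphismProperty.of_isPullback h.flip ‹_›
  have : UniversallyInjective f' := MorphismProperty.of_isPullback h.flip ‹_›
  have : Surjective f' := MorphismProperty.of_isPullback h.flip ‹_›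
  exact isHomeomorph_iff_continuous_isClosedMap_bijective.mpr
    ⟨f'.continuous, f'.isClosedMap, f'.injective, f'.surjective⟩

theorem universallyInjective_of_isAlgClosed {R S : Type} [CommRing R] [CommRing S] (ψ : R →+* S)
    (h : ∀ (L : Type) [Field L] [IsAlgClosed L] (a b : S →+* L),
      a.comp ψ = b.comp ψ → a = b) :
    UniversallyInjective (Spec.map (CommRingCat.ofHom ψ)) := by
  have hiff : UniversallyInjective (Spec.map (CommRingCat.ofHom ψ)) ↔
      ∀ (K : Type) [Field K], Function.Injective
        fun g : Spec (.of K) ⟶ Spec (.of S) ↦ g ≫ Spec.map (CommRingCat.ofHom ψ) :=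
    (tfae_universallyInjective _).out 0 1
  refine hiff.mpr fun K _ g₁ g₂ hg ↦ ?_
  obtain ⟨a, rfl⟩ := Spec.map_surjective g₁
  obtain ⟨b, rfl⟩ := Spec.map_surjective g₂
  simp only [← Spec.map_comp] at hg
  have hg : a.hom.comp ψ = b.hom.comp ψ := congrArg CommRingCat.Hom.hom (Spec.map_injective hg)
  let i : K →+* AlgebraicClosure K := algebraMap K (AlgebraicClosure K)
  have key := h (AlgebraicClosure K) (i.comp a.hom) (i.comp b.hom) (congrArg (RingHom.comp i) hg)
  congr 1
  ext x
  exact i.injective (DFunLike.congr_fun key x)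

theorem Algebra.IsAlgebraic.exists_forall_isIntegral_pow_smul (R S : Type*) [CommRing R]
    [CommRing S] [IsDomain R] [Algebra R S] [Algebra.FiniteType R S] [Algebra.IsAlgebraic R S] :
    ∃ r : R, r ≠ 0 ∧ ∀ s : S, ∃ k : ℕ, IsIntegral R (r ^ k • s) := by
  obtain ⟨T, hT⟩ := Algebra.FiniteType.out (R := R) (A := S)
  obtain ⟨r, hr, h⟩ := Algebra.IsAlgebraic.exists_integral_multiples R T
  refine ⟨r, hr, fun s ↦ ?_⟩
  have hs : s ∈ Algebra.adjoin R (T : Set S) := hT ▸ Algebra.mem_top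
  induction hs using Algebra.adjoin_induction with
  | mem x hx => exact ⟨1, by simpa using h x hx⟩
  | algebraMap c => exact ⟨0, by simpa using isIntegral_algebraMap⟩
  | add x y _ _ hx hy =>
    obtain ⟨k, hk⟩ := hx
    obtain ⟨l, hl⟩ := hy
    refine ⟨k + l, ?_⟩
    convert (hk.smul (r ^ l)).add (hl.smul (r ^ k)) using 1
    simp only [smul_smul, smul_add, pow_add, mul_comm]
  | mul x y _ _ hx hy =>
    obtain ⟨k, hk⟩ := hx
    obtain ⟨l, hl⟩ := hy
    refine ⟨k + l, ?_⟩
    convert hk.mul hl using 1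
    rw [smul_mul_smul_comm, pow_add]

theorem IsLocalization.Away.isIntegral_map_of_isIntegral_pow_smul {R S : Type*} [CommRing R]
    [CommRing S] [Algebra R S] (r : R) (R' S' : Type*) [CommRing R'] [CommRing S'] [Algebra R R']
    [Algebra S S'] [IsLocalization.Away r R'] [IsLocalization.Away (algebraMap R S r) S']
    (h : ∀ s : S, ∃ k : ℕ, IsIntegral R (r ^ k • s)) :
    (IsLocalization.Away.map R' S' (algebraMap R S) r).IsIntegral := by
  let : Algebra R' S' := (IsLocalization.Away.map R' S' (algebraMap R S) r).toAlgebra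
  let : Algebra R S' := ((algebraMap S S').comp (algebraMap R S)).toAlgebra
  have : IsScalarTower R S S' := .of_algebraMap_eq fun x ↦ rfl
  have : IsScalarTower R R' S' := .of_algebraMap_eq fun x ↦ by
    rw [RingHom.algebraMap_toAlgebra (IsLocalization.Away.map R' S' (algebraMap R S) r),
      IsLocalization.Away.map, IsLocalization.map_eq]
    rfl
  intro x
  obtain ⟨n, s, hs⟩ := IsLocalization.Away.surj (algebraMap R S r) x
  obtain ⟨k, hk⟩ := h s
  have hk : IsIntegral R' (algebraMap S S' (r ^ k • s)) :=
    (hk.map (IsScalarTower.toAlgHom R S S')).tower_top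
  obtain ⟨u, hu⟩ := IsLocalization.Away.algebraMap_isUnit (S := R') r
  have hur : algebraMap R' S' ↑u⁻¹ * algebraMap R S' r = 1 := by
    rw [IsScalarTower.algebraMap_apply R R' S', ← hu, ← map_mul]
    simp
  have : x = algebraMap S S' (r ^ k • s) * algebraMap R' S' (↑u⁻¹ ^ (n + k)) := by
    rw [Algebra.smul_def, map_mul, ← hs]
    simp only [map_pow, ← IsScalarTower.algebraMap_apply]
    calc x = x * (algebraMap R' S' ↑u⁻¹ * algebraMap R S' r) ^ (n + k) := by rw [hur]; simp
      _ = _ := by ring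
  rw [this]
  exact hk.mul isIntegral_algebraMap

/-- The subset `E` of `Spec B` is the graph of a function on `C ⊆ Spec A`, on points with values
in algebraically closed fields. -/
def IsGeometricGraph {A B : Type} [CommRing A] [CommRing B] (φ : A →+* B)
    (C : Set (PrimeSpectrum A)) (E : Set (PrimeSpectrum B)) : Prop :=
  ∀ (L : Type) [Field L] [IsAlgClosed L],
    (∀ b : B →+* L, PrimeSpectrum.comap b ⊥ ∈ E →
      PrimeSpectrum.comap (b.comp φ) ⊥ ∈ C) ∧
    ∀ a : A →+* L, PrimeSpectrum.comap a ⊥ ∈ C →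
      ∃! b : B →+* L, PrimeSpectrum.comap b ⊥ ∈ E ∧ b.comp φ = a

theorem PrimeSpectrum.comap_bot_eq_iff {A L : Type*} [CommRing A] [Field L] {a : A →+* L}
    {p : PrimeSpectrum A} : comap a ⊥ = p ↔ RingHom.ker a = p.asIdeal :=
  PrimeSpectrum.ext_iff

theorem PrimeSpectrum.comap_bot_of_injective {K L : Type*} [Field K] [Field L] (σ : K →+* L) :
    comap σ ⊥ = ⊥ :=
  comap_bot_eq_iff.mpr ((RingHom.injective_iff_ker_eq_bot σ).mp σ.injective)

theorem AlgebraicClosure.exists_ringHom_comp_algebraMap_eq {K L : Type*} [Field K] [Field L]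
    [IsAlgClosed L] (τ : K →+* L) :
    ∃ σ : AlgebraicClosure K →+* L, σ.comp (algebraMap K (AlgebraicClosure K)) = τ := by
  let := τ.toAlgebra
  exact ⟨(IsAlgClosed.lift : AlgebraicClosure K →ₐ[K] L), AlgHom.comp_algebraMap _⟩

theorem PrimeSpectrum.exists_ringHom_algebraicClosure {A L : Type*} [CommRing A]
    (p : PrimeSpectrum A) [Field L] [IsAlgClosed L] (a : A →+* L) (ha : comap a ⊥ = p) :
    ∃ σ : AlgebraicClosure p.asIdeal.ResidueField →+* L,
      σ.comp (algebraMap A (AlgebraicClosure p.asIdeal.ResidueField)) = a := by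
  have ha' := comap_bot_eq_iff.mp ha
  have hunit : p.asIdeal.primeCompl ≤ (IsUnit.submonoid L).comap a := fun x hx ↦ by
    rw [Submonoid.mem_comap, IsUnit.mem_submonoid_iff, isUnit_iff_ne_zero]
    exact fun h ↦ hx (ha' ▸ RingHom.mem_ker.mpr h)
  obtain ⟨σ, hσ⟩ := AlgebraicClosure.exists_ringHom_comp_algebraMap_eq
    (Ideal.ResidueField.lift p.asIdeal a ha'.ge hunit)
  refine ⟨σ, RingHom.ext fun x ↦ ?_⟩
  rw [IsScalarTower.algebraMap_eq A p.asIdeal.ResidueField, ← RingHom.comp_assoc, hσ]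
  exact Ideal.ResidueField.lift_algebraMap p.asIdeal a ha'.ge hunit x

theorem PrimeSpectrum.comap_algebraMap_algebraicClosure_bot {A : Type*} [CommRing A]
    (p : PrimeSpectrum A) :
    comap (algebraMap A (AlgebraicClosure p.asIdeal.ResidueField)) ⊥ = p := by
  rw [comap_bot_eq_iff, IsScalarTower.algebraMap_eq A p.asIdeal.ResidueField,
    RingHom.ker_comp_of_injective _ (RingHom.injective _),
    Ideal.ker_algebraMap_residueField]

namespace IsGeometricGraph

variable {A B : Type} [CommRing A] [CommRing B] [Algebra A B]
  {C : Set (PrimeSpectrum A)} {E : Set (PrimeSpectrum B)}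

open PrimeSpectrum

/-- Over a point `p` of `C` there is exactly one point of `E`, and its residue field is algebraic
over that of `p`. -/
theorem exists_mem_fiber (h : IsGeometricGraph (algebraMap A B) C E) {p : PrimeSpectrum A}
    (hp : p ∈ C) : ∃ q ∈ E, (∀ q' ∈ E, comap (algebraMap A B) q' = p → q' = q) ∧
      ∃ _ : q.asIdeal.LiesOver p.asIdeal,
        Algebra.IsAlgebraic (A ⧸ p.asIdeal) (B ⧸ q.asIdeal) := by
  let K := p.asIdeal.ResidueField
  let L := AlgebraicClosure K
  obtain ⟨b, ⟨hbE, hb⟩, -⟩ := (h L).2 (algebraMap A L)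
    (p.comap_algebraMap_algebraicClosure_bot.symm ▸ hp)
  have hker : p.asIdeal = (comap b ⊥).asIdeal.comap (algebraMap A B) := by
    rw [← comap_asIdeal, ← comap_comp_apply, hb, comap_algebraMap_algebraicClosure_bot]
  have hover : (comap b ⊥).asIdeal.LiesOver p.asIdeal := ⟨hker⟩
  refine ⟨comap b ⊥, hbE, fun q' hq' hqp ↦ ?_, hover, ?_⟩
  · let L' := AlgebraicClosure q'.asIdeal.ResidueField
    have hq'L : comap (algebraMap B L') ⊥ = q' := q'.comap_algebraMap_algebraicClosure_bot
    have hpL' : comap ((algebraMap B L').comp (algebraMap A B)) ⊥ = p := by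
      rw [comap_comp_apply, hq'L, hqp]
    obtain ⟨σ, hσ⟩ := p.exists_ringHom_algebraicClosure
      ((algebraMap B L').comp (algebraMap A B)) hpL'
    have hσb : comap (σ.comp b) ⊥ = comap b ⊥ := by
      rw [comap_comp_apply, comap_bot_of_injective]
    have := ((h L').2 _ (hpL'.symm ▸ hp)).unique (y₁ := σ.comp b) (y₂ := algebraMap B L')
      ⟨hσb.symm ▸ hbE, by rw [RingHom.comp_assoc, hb, hσ]⟩ ⟨hq'L.symm ▸ hq', rfl⟩
    rw [← hq'L, ← this, hσb]
  · let b' : B ⧸ (comap b ⊥).asIdeal →+* L := Ideal.Quotient.lift _ b fun x hx ↦ hx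
    have hb' : Function.Injective b' :=
      RingHom.lift_injective_of_ker_le_ideal _ _ (le_refl (RingHom.ker b))
    have : Algebra.IsAlgebraic (A ⧸ p.asIdeal) L :=
      (IsFractionRing.comap_isAlgebraic_iff (K := K)).mpr inferInstance
    let b'' : B ⧸ (comap b ⊥).asIdeal →ₐ[A ⧸ p.asIdeal] L :=
      { b' with
        commutes' := fun x ↦ by
          obtain ⟨x, rfl⟩ := Ideal.Quotient.mk_surjective x
          exact (DFunLike.congr_fun hb x).trans
            (IsScalarTower.algebraMap_apply A (A ⧸ p.asIdeal) L x) }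
    exact ⟨fun x ↦ (isAlgebraic_algHom_iff b'' hb').mp (Algebra.IsAlgebraic.isAlgebraic _)⟩

end IsGeometricGraph

theorem PrimeSpectrum.eq_of_le_of_comap_eq {A B : Type*} [CommRing A] [CommRing B] [Algebra A B]
    {p : PrimeSpectrum A} {q q' : PrimeSpectrum B} [q.asIdeal.LiesOver p.asIdeal]
    [Algebra.IsAlgebraic (A ⧸ p.asIdeal) (B ⧸ q.asIdeal)] (hle : q ≤ q')
    (hq' : comap (algebraMap A B) q' = p) : q' = q := by
  refine le_antisymm (fun x hx ↦ ?_) hle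
  by_contra hxq
  refine Ideal.comap_ne_bot_of_algebraic_mem (R := A ⧸ p.asIdeal)
    (I := q'.asIdeal.map (Ideal.Quotient.mk q.asIdeal)) (x := Ideal.Quotient.mk q.asIdeal x)
    (by rwa [ne_eq, Ideal.Quotient.eq_zero_iff_mem])
    (Ideal.mem_map_of_mem _ hx) (Algebra.IsAlgebraic.isAlgebraic _) (eq_bot_iff.mpr fun y hy ↦ ?_)
  obtain ⟨y, rfl⟩ := Ideal.Quotient.mk_surjective y
  rw [Ideal.mem_comap, Ideal.Quotient.algebraMap_mk_of_liesOver,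
    Ideal.mem_map_iff_of_surjective _ Ideal.Quotient.mk_surjective] at hy
  obtain ⟨z, hz, hzy⟩ := hy
  rw [Ideal.mem_bot, Ideal.Quotient.eq_zero_iff_mem, ← hq']
  have := q'.asIdeal.sub_mem hz (hle (Ideal.Quotient.eq.mp hzy))
  simpa using this

open PrimeSpectrum in
/-- After shrinking to a basic open set, `C` and `E` become basic open subsets `Spec (A/p)_f` and
`Spec (B/q)_f` of irreducible closed sets, the second being integral over the first. -/
theorem IsGeometricGraph.exists_eq_zeroLocus_inter_basicOpen {A B : Type} [CommRing A]
    [CommRing B] [Algebra A B] [IsNoetherianRing A] [Algebra.FinitePresentation A B]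
    {C : Set (PrimeSpectrum A)} {E : Set (PrimeSpectrum B)}
    (h : IsGeometricGraph (algebraMap A B) C E) (hC : Topology.IsConstructible C)
    (hCne : C.Nonempty) (hE : Topology.IsConstructible E) :
    ∃ (p : PrimeSpectrum A) (f : A) (q : PrimeSpectrum B) (_ : q.asIdeal.LiesOver p.asIdeal),
      f ∉ p.asIdeal ∧ p ∈ C ∧
      (basicOpen f : Set (PrimeSpectrum A)) ∩ C = zeroLocus p.asIdeal ∩ basicOpen f ∧
      E ∩ comap (algebraMap A B) ⁻¹' (basicOpen f ∩ C) =
        zeroLocus q.asIdeal ∩ basicOpen (algebraMap A B f) ∧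
      ∀ s : B ⧸ q.asIdeal,
        ∃ k : ℕ, IsIntegral (A ⧸ p.asIdeal) (Ideal.Quotient.mk p.asIdeal f ^ k • s) := by
  have : IsNoetherianRing B := Algebra.FiniteType.isNoetherianRing A B
  obtain ⟨p, hp, O, hO, hpO, hOC⟩ := hC.exists_isOpen_inter_subset_closure hCne
  obtain ⟨q, hq, huniq, hover, halg⟩ := h.exists_mem_fiber hp
  have hclq : Topology.IsConstructible (closure {q}) :=
    (TopologicalSpace.NoetherianSpace.isCompact _).isConstructible
      isClosed_closure.isOpen_compl |>.of_compl
  have hFP : (algebraMap A B).FinitePresentation :=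
    RingHom.finitePresentation_algebraMap.mpr inferInstance
  have avoid (D : Set (PrimeSpectrum B)) (hD : Topology.IsConstructible D)
      (hpD : ∀ x ∈ D, comap (algebraMap A B) x ≠ p) :
      ∃ O : Set (PrimeSpectrum A), IsOpen O ∧ p ∈ O ∧
        ∀ x ∈ D, comap (algebraMap A B) x ∈ O → comap (algebraMap A B) x ∉ closure {p} := by
    obtain ⟨O, hO, hpO, h⟩ :=
      (isConstructible_comap_image hFP hD).compl.exists_isOpen_inter_closure_subset (x := p)
        fun ⟨x, hx, hxp⟩ ↦ hpD x hx hxp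
    exact ⟨O, hO, hpO, fun x hx hxO hxp ↦ h ⟨hxO, hxp⟩ ⟨x, hx, rfl⟩⟩
  obtain ⟨O₁, hO₁, hpO₁, h₁⟩ := hC.exists_isOpen_inter_closure_subset hp
  obtain ⟨O₂, hO₂, hpO₂, h₂⟩ := avoid (E \ closure {q}) (hE.sdiff hclq)
    fun x hx hxp ↦ hx.2 (huniq x hx.1 hxp ▸ subset_closure rfl)
  obtain ⟨O₃, hO₃, hpO₃, h₃⟩ := avoid (closure {q} \ E) (hclq.sdiff hE)
    fun x hx hxp ↦ hx.2 <| by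
      have hle : q ≤ x := le_iff_specializes q x |>.mpr (specializes_iff_mem_closure.mpr hx.1)
      exact (eq_of_le_of_comap_eq hle hxp).symm ▸ hq
  obtain ⟨r, hr, hint⟩ :=
    Algebra.IsAlgebraic.exists_forall_isIntegral_pow_smul (A ⧸ p.asIdeal) (B ⧸ q.asIdeal)
  obtain ⟨r, rfl⟩ := Ideal.Quotient.mk_surjective r
  obtain ⟨_, ⟨f, rfl⟩, hpf, hf⟩ := isTopologicalBasis_basic_opens.exists_subset_of_mem_open
    (show p ∈ O ∩ O₁ ∩ O₂ ∩ O₃ from ⟨⟨⟨hpO, hpO₁⟩, hpO₂⟩, hpO₃⟩)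
    (((hO.inter hO₁).inter hO₂).inter hO₃)
  rw [ne_eq, Ideal.Quotient.eq_zero_iff_mem] at hr
  have hfr : (basicOpen (f * r) : Set (PrimeSpectrum A)) ⊆ basicOpen f := by
    rw [basicOpen_mul]
    exact Set.inter_subset_left
  have hfO := hfr.trans hf
  have hU : (basicOpen (f * r) : Set (PrimeSpectrum A)) ∩ C =
      zeroLocus p.asIdeal ∩ basicOpen (f * r) := by
    rw [← PrimeSpectrum.closure_singleton]
    ext x
    exact ⟨fun hx ↦ ⟨hOC ⟨(hfO hx.1).1.1.1, hx.2⟩, hx.1⟩,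
      fun hx ↦ ⟨hx.2, h₁ ⟨(hfO hx.2).1.1.2, hx.1⟩⟩⟩
  refine ⟨p, f * r, q, hover, fun hmem ↦ (p.2.mem_or_mem hmem).elim hpf hr, hp, hU, ?_,
    fun s ↦ ?_⟩
  · rw [hU, ← PrimeSpectrum.closure_singleton, ← PrimeSpectrum.closure_singleton]
    ext x
    refine ⟨fun ⟨hxE, hxp, hxf⟩ ↦ ⟨?_, hxf⟩, fun ⟨hxq, hxf⟩ ↦ ?_⟩
    · by_contra hxq
      exact h₂ x ⟨hxE, hxq⟩ (hfO hxf).1.2 hxp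
    · have hxf : comap (algebraMap A B) x ∈ (basicOpen (f * r) : Set (PrimeSpectrum A)) := hxf
      have hxp : comap (algebraMap A B) x ∈ closure {p} := by
        have hqp : comap (algebraMap A B) q = p := PrimeSpectrum.ext hover.over.symm
        rw [← specializes_iff_mem_closure, ← hqp]
        exact (specializes_iff_mem_closure.mpr hxq).map
          (continuous_comap (algebraMap A B))
      refine ⟨?_, hxp, hxf⟩
      by_contra hxE
      exact h₃ x ⟨hxq, hxE⟩ (hfO hxf).2 hxp
  · obtain ⟨k, hk⟩ := hint s
    refine ⟨k, ?_⟩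
    rw [map_mul, mul_pow, mul_smul]
    exact hk.smul _

theorem isImmersion_SpecMap_of_isLocalization_away_quotient {A : Type} [CommRing A] (I : Ideal A)
    (f : A) (R : Type) [CommRing R] [Algebra (A ⧸ I) R]
    [IsLocalization.Away (Ideal.Quotient.mk I f) R] :
    IsImmersion (Spec.map (CommRingCat.ofHom
      ((algebraMap (A ⧸ I) R).comp (Ideal.Quotient.mk I)))) := by
  have : IsOpenImmersion (Spec.map (CommRingCat.ofHom (algebraMap (A ⧸ I) R))) :=
    IsOpenImmersion.of_isLocalization (Ideal.Quotient.mk I f)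
  have : IsClosedImmersion (Spec.map (CommRingCat.ofHom (Ideal.Quotient.mk I))) :=
    IsClosedImmersion.spec_of_surjective _ Ideal.Quotient.mk_surjective
  rw [CommRingCat.ofHom_comp, Spec.map_comp]
  infer_instance

open PrimeSpectrum in
theorem PrimeSpectrum.range_comap_of_isLocalization_away_quotient {A : Type*} [CommRing A]
    (I : Ideal A) (f : A) (R : Type*) [CommRing R] [Algebra (A ⧸ I) R]
    [IsLocalization.Away (Ideal.Quotient.mk I f) R] :
    Set.range (comap ((algebraMap (A ⧸ I) R).comp (Ideal.Quotient.mk I))) =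
      zeroLocus I ∩ basicOpen f := by
  rw [comap_comp, Set.range_comp, localization_away_comap_range R (Ideal.Quotient.mk I f)]
  have : (basicOpen (Ideal.Quotient.mk I f) : Set (PrimeSpectrum (A ⧸ I))) =
    comap (Ideal.Quotient.mk I) ⁻¹' basicOpen f := rfl
  rw [this, Set.image_preimage_eq_range_inter,
    range_comap_of_surjective _ _ Ideal.Quotient.mk_surjective, Ideal.mk_ker]

theorem IsLocalization.Away.isUniversalHomeomorphism_map {R S : Type} [CommRing R] [CommRing S]
    [Algebra R S] (r : R) (R' S' : Type) [CommRing R'] [CommRing S'] [Algebra R R']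
    [Algebra S S'] [IsLocalization.Away r R'] [IsLocalization.Away (algebraMap R S r) S']
    (hinj : Function.Injective (algebraMap R S))
    (hint : ∀ s : S, ∃ k : ℕ, IsIntegral R (r ^ k • s))
    (h : ∀ (L : Type) [Field L] [IsAlgClosed L] (a b : S' →+* L),
      (a.comp (algebraMap S S')).comp (algebraMap R S) =
        (b.comp (algebraMap S S')).comp (algebraMap R S) → a = b) :
    IsUniversalHomeomorphism (Spec.map (CommRingCat.ofHom
      (IsLocalization.Away.map R' S' (algebraMap R S) r))) := by
  set ψ := IsLocalization.Away.map R' S' (algebraMap R S) r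
  have hψ : ψ.comp (algebraMap R R') = (algebraMap S S').comp (algebraMap R S) :=
    IsLocalization.map_comp _
  have hψi : ψ.IsIntegral := isIntegral_map_of_isIntegral_pow_smul r R' S' hint
  have hψinj : Function.Injective ψ := by
    have : IsLocalization ((Submonoid.powers r).map (algebraMap R S)) S' := by
      rwa [Submonoid.map_powers]
    exact IsLocalization.map_injective_of_injective (.powers r) R' S' hinj
  have : IsIntegralHom (Spec.map (CommRingCat.ofHom ψ)) := IsIntegralHom.SpecMap_iff.mpr hψi
  have : UniversallyInjective (Spec.map (CommRingCat.ofHom ψ)) :=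
    universallyInjective_of_isAlgClosed ψ fun L _ _ a b hab ↦ h L a b <| by
      simp only [RingHom.comp_assoc, ← hψ]
      simp only [← RingHom.comp_assoc, hab]
  have : Surjective (Spec.map (CommRingCat.ofHom ψ)) :=
    ⟨hψi.comap_surjective hψinj⟩
  exact isUniversalHomeomorphism_of_isIntegralHom _

theorem MvPolynomial.aeval_toRingHom_eq {F L : Type*} [Field F] [Field L] [Algebra F L]
    {σ : Type*} (a : MvPolynomial σ F →+* L) (ha : a.comp C = algebraMap F L) :
    (aeval fun i ↦ a (X i) : MvPolynomial σ F →ₐ[F] L).toRingHom = a := by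
  refine MvPolynomial.ringHom_ext (fun r ↦ ?_) fun i ↦ ?_
  · simpa using (DFunLike.congr_fun ha r).symm
  · simp

theorem mem_Lpoints_iff (F : Type) [Field F] (r : ℕ) (D : Set (AffSp F r)) (L : Type) [Field L]
    [Algebra F L] (e : Fin r → L) : e ∈ Lpoints F r D L ↔
      PrimeSpectrum.comap
        (MvPolynomial.aeval e : MvPolynomial (Fin r) F →ₐ[F] L).toRingHom ⊥ ∈ D :=
  Iff.rfl

open MvPolynomial in
theorem isGeometricGraph_rename (F : Type) [Field F] (m n : ℕ)
    (C : Set (AffSp F m)) (E : Set (AffSp F (m + n)))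
    (hgraph : ∀ (L : Type) [Field L] [Algebra F L] [IsAlgClosed L],
      (∀ e ∈ Lpoints F (m + n) E L, (fun i => e (Fin.castAdd n i)) ∈ Lpoints F m C L) ∧
      (∀ c ∈ Lpoints F m C L,
        ∃! e, e ∈ Lpoints F (m + n) E L ∧ (fun i => e (Fin.castAdd n i)) = c)) :
    IsGeometricGraph
      (rename (Fin.castAdd n) :
        MvPolynomial (Fin m) F →ₐ[F] MvPolynomial (Fin (m + n)) F).toRingHom
      C E := by
  set φ := (rename (Fin.castAdd n) :
    MvPolynomial (Fin m) F →ₐ[F] MvPolynomial (Fin (m + n)) F).toRingHom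
  have hφC : φ.comp MvPolynomial.C = MvPolynomial.C := RingHom.ext fun r ↦ rename_C _ r
  have hφX (i : Fin m) : φ (X i) = X (Fin.castAdd n i) := rename_X _ i
  intro L _ _
  refine ⟨fun b hb ↦ ?_, fun a ha ↦ ?_⟩
  · let := (b.comp MvPolynomial.C).toAlgebra
    have hb' := aeval_toRingHom_eq b rfl
    have hbφ := aeval_toRingHom_eq (b.comp φ) (by rw [RingHom.comp_assoc, hφC]; rfl)
    have := (hgraph L).1 (fun i ↦ b (X i)) (by rwa [mem_Lpoints_iff, hb'])
    have hX : (fun i ↦ (b.comp φ) (X i)) = fun i ↦ b (X (Fin.castAdd n i)) :=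
      funext fun i ↦ congrArg b (hφX i)
    rw [hX] at hbφ
    rwa [mem_Lpoints_iff, hbφ] at this
  · let := (a.comp MvPolynomial.C).toAlgebra
    have ha' := aeval_toRingHom_eq a rfl
    obtain ⟨e, ⟨heE, hec⟩, huniq⟩ :=
      (hgraph L).2 (fun i ↦ a (X i)) (by rwa [mem_Lpoints_iff, ha'])
    refine ⟨(aeval e : MvPolynomial (Fin (m + n)) F →ₐ[F] L).toRingHom, ⟨heE, ?_⟩,
      fun b ⟨hbE, hba⟩ ↦ ?_⟩
    · refine MvPolynomial.ringHom_ext (fun r ↦ ?_) fun i ↦ ?_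
      · rw [RingHom.comp_apply, ← RingHom.comp_apply φ, hφC]
        exact aeval_C _ r
      · rw [RingHom.comp_apply, hφX, ← congrFun hec i]
        exact aeval_X _ _
    · have hb' := aeval_toRingHom_eq b (by rw [← hφC, ← RingHom.comp_assoc, hba]; rfl)
      rw [← hb', ← huniq (fun i ↦ b (X i)) ⟨by rwa [mem_Lpoints_iff, hb'], ?_⟩]
      funext i
      rw [← hba, RingHom.comp_apply, hφX]

theorem IsGeometricGraph.isUniversalHomeomorphism_awayMap {A B : Type} [CommRing A]
    [CommRing B] [Algebra A B] {C : Set (PrimeSpectrum A)} {E : Set (PrimeSpectrum B)}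
    (h : IsGeometricGraph (algebraMap A B) C E) (I : Ideal A) (J : Ideal B) [J.LiesOver I] (f : A)
    (R' S' : Type) [CommRing R'] [CommRing S'] [Algebra (A ⧸ I) R'] [Algebra (B ⧸ J) S']
    [IsLocalization.Away (Ideal.Quotient.mk I f) R']
    [IsLocalization.Away (algebraMap (A ⧸ I) (B ⧸ J) (Ideal.Quotient.mk I f)) S']
    (hrange : Set.range (PrimeSpectrum.comap ((algebraMap (B ⧸ J) S').comp
      (Ideal.Quotient.mk J))) ⊆ E)
    (hint : ∀ s : B ⧸ J, ∃ k : ℕ, IsIntegral (A ⧸ I) (Ideal.Quotient.mk I f ^ k • s)) :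
    IsUniversalHomeomorphism (Spec.map (CommRingCat.ofHom (IsLocalization.Away.map R' S'
      (algebraMap (A ⧸ I) (B ⧸ J)) (Ideal.Quotient.mk I f)))) := by
  refine IsLocalization.Away.isUniversalHomeomorphism_map _ R' S'
    (FaithfulSMul.algebraMap_injective _ _) hint fun L _ _ a b hab ↦ ?_
  have hmem (a : S' →+* L) : PrimeSpectrum.comap
      (a.comp ((algebraMap (B ⧸ J) S').comp (Ideal.Quotient.mk J))) ⊥ ∈ E := by
    rw [PrimeSpectrum.comap_comp_apply]
    exact hrange ⟨_, rfl⟩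
  have hab' : (b.comp ((algebraMap (B ⧸ J) S').comp (Ideal.Quotient.mk J))).comp
      (algebraMap A B) = (a.comp ((algebraMap (B ⧸ J) S').comp (Ideal.Quotient.mk J))).comp
      (algebraMap A B) := by
    ext x
    simpa using (DFunLike.congr_fun hab (Ideal.Quotient.mk I x)).symm
  have key := ((h L).2 _ ((h L).1 _ (hmem a))).unique ⟨hmem a, rfl⟩ ⟨hmem b, hab'⟩
  refine IsLocalization.ringHom_ext
    (.powers (algebraMap (A ⧸ I) (B ⧸ J) (Ideal.Quotient.mk I f))) ?_
  exact Ideal.Quotient.ringHom_ext key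

/-- `C` is a nonempty constructible subset of `𝔸^m_F`, `E` is a constructible
subset of `𝔸^{m+n}_F`, and for every algebraically closed field `L` containing `F` the
set `E(L)` is the graph of a function with domain of definition `C(L)`.  Then there is
a nonempty subset `U` of `C`, open in `C` and locally closed in `𝔸^m_F`, such that
`V := E ∩ π⁻¹(U)` is locally closed in `𝔸^{m+n}_F` and the morphism `V ⟶ U` induced by
the projection `π` (with `U`, `V` carrying their reduced induced structures, i.e.
realized as reduced schemes `U'`, `V'` immersed in the affine spaces with images `U`,
`V`) is a universal homeomorphism. -/
theorem statement6 (F : Type) [Field F] (m n : ℕ)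
    (C : Set (AffSp F m)) (E : Set (AffSp F (m + n)))
    (hC : IsConstructibleSet C) (hCne : C.Nonempty) (hE : IsConstructibleSet E)
    (hgraph : ∀ (L : Type) [Field L] [Algebra F L] [IsAlgClosed L],
      (∀ e ∈ Lpoints F (m + n) E L, (fun i => e (Fin.castAdd n i)) ∈ Lpoints F m C L) ∧
      (∀ c ∈ Lpoints F m C L,
        ∃! e, e ∈ Lpoints F (m + n) E L ∧ (fun i => e (Fin.castAdd n i)) = c)) :
    ∃ U : Set (AffSp F m),
      U.Nonempty ∧ U ⊆ C ∧
      (∃ O : Set (AffSp F m), IsOpen O ∧ U = O ∩ C) ∧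
      IsLocallyClosed U ∧
      IsLocallyClosed (E ∩ (projAff F m n).base ⁻¹' U) ∧
      ∃ (U' V' : Scheme) (jU : U' ⟶ AffSp F m) (jV : V' ⟶ AffSp F (m + n)) (g : V' ⟶ U'),
        IsReduced U' ∧ IsImmersion jU ∧ Set.range jU.base = U ∧
        IsReduced V' ∧ IsImmersion jV ∧
        Set.range jV.base = E ∩ (projAff F m n).base ⁻¹' U ∧
        jV ≫ projAff F m n = g ≫ jU ∧
        IsUniversalHomeomorphism g := by
  let A := MvPolynomial (Fin m) F
  let B := MvPolynomial (Fin (m + n)) F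
  let φ : A →ₐ[F] B := MvPolynomial.rename (Fin.castAdd n)
  algebraize [φ.toRingHom]
  have : IsScalarTower F A B := .of_algebraMap_eq fun r ↦ (φ.commutes r).symm
  have : Algebra.FinitePresentation A B :=
    .of_restrict_scalars_finitePresentation F A B
  have hgeom : IsGeometricGraph (algebraMap A B) C E := isGeometricGraph_rename F m n C E hgraph
  have hC' : Topology.IsConstructible (X := PrimeSpectrum A) C :=
    IsConstructibleSet.isConstructible (X := PrimeSpectrum A) hC
  have hE' : Topology.IsConstructible (X := PrimeSpectrum B) E :=
    IsConstructibleSet.isConstructible (X := PrimeSpectrum B) hE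
  obtain ⟨p, f, q, hover, hpf, hpC, hU, hV, hint⟩ :=
    hgeom.exists_eq_zeroLocus_inter_basicOpen hC' hCne hE'
  let R := A ⧸ p.asIdeal
  let S := B ⧸ q.asIdeal
  let r : R := Ideal.Quotient.mk p.asIdeal f
  let R' := Localization.Away r
  let S' := Localization.Away (algebraMap R S r)
  have : IsLocalization.Away (Ideal.Quotient.mk q.asIdeal (algebraMap A B f)) S' :=
    inferInstanceAs (IsLocalization.Away (algebraMap R S r) S')
  have hrangeU := PrimeSpectrum.range_comap_of_isLocalization_away_quotient p.asIdeal f R'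
  have hrangeV := PrimeSpectrum.range_comap_of_isLocalization_away_quotient q.asIdeal
    (algebraMap A B f) S'
  rw [← hU] at hrangeU
  rw [← hV] at hrangeV
  have himU := isImmersion_SpecMap_of_isLocalization_away_quotient p.asIdeal f R'
  have himV := isImmersion_SpecMap_of_isLocalization_away_quotient q.asIdeal (algebraMap A B f) S'
  have : _root_.IsReduced R' := inferInstanceAs (_root_.IsReduced (Localization (.powers r)))
  have : _root_.IsReduced S' :=
    inferInstanceAs (_root_.IsReduced (Localization (.powers (algebraMap R S r))))
  refine ⟨(PrimeSpectrum.basicOpen f : Set (PrimeSpectrum A)) ∩ C, ⟨p, hpf, hpC⟩,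
    Set.inter_subset_right, ⟨_, (PrimeSpectrum.basicOpen f).isOpen, rfl⟩, ?_, ?_,
    Spec (.of R'), Spec (.of S'), _, _,
    Spec.map (CommRingCat.ofHom (IsLocalization.Away.map R' S' (algebraMap R S) r)),
    ?_, himU, hrangeU, ?_, himV, hrangeV, ?_, ?_⟩
  · exact hrangeU ▸ himU.isLocallyClosed_range
  · exact hrangeV ▸ himV.isLocallyClosed_range
  · infer_instance
  · infer_instance
  · rw [projAff, ← Spec.map_comp, ← Spec.map_comp, ← CommRingCat.ofHom_comp,
      ← CommRingCat.ofHom_comp, ← RingHom.comp_assoc]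
    congr 2
    rw [IsLocalization.Away.map, IsLocalization.map_comp]
    rfl
  · exact hgeom.isUniversalHomeomorphism_awayMap p.asIdeal q.asIdeal f R' S'
      (hrangeV ▸ Set.inter_subset_left) hint
end
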